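/- arXiv:2510.00889 — 2 statements merged into one kernel-verified Lean document; each statement's English description precedes it below -/
import Mathlib

section
/- Let r ≥ 3 and suppose the free generating set {x_1,…,x_r} of F_r is partitioned into two disjoint nonempty subsets X and Y. Let ⟨X⟩ and ⟨Y⟩ denote the subgroups of F_r generated by X and Y, respectively. If w = w_X w_Y with w_X ∈ ⟨X⟩ and w_Y ∈ ⟨Y⟩, then w is not primitivity-blocking; that is, there exists a cyclically reduced primitive element p of F_r whose reduced word contains the reduced word of w as a contiguous subword (infix). -/
/-- `FG r` is the free group `F_r` of rank `r`, with free generating set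
`x_1, …, x_r` given by `FreeGroup.of 0, …, FreeGroup.of (r-1)`. -/
abbrev FG (r : ℕ) := FreeGroup (Fin r)

/-- `|w|`, the length of the reduced word representing `w`. -/
def wordLength {r : ℕ} (w : FG r) : ℕ := w.toWord.length

/-- `w` is cyclically reduced: its reduced word is empty, or its first letter is not
the inverse of its last letter.  (A letter `(i, b)` has inverse `(i, !b)`.) -/
def CyclicallyReduced {r : ℕ} (w : FG r) : Prop :=
  ∀ a ∈ w.toWord.head?, ∀ b ∈ w.toWord.getLast?, a ≠ (b.1, !b.2)

/-- `p` is a primitive element of `F_r`: the image of `x_1` under some automorphism. -/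
def Primitive {r : ℕ} (hr : 0 < r) (p : FG r) : Prop :=
  ∃ φ : FG r ≃* FG r, φ (FreeGroup.of ⟨0, hr⟩) = p

/-- `v` is primitivity-blocking: the reduced word of `v` is not an infix of the reduced
word of any cyclically reduced primitive element of `F_r`. -/
def PrimitivityBlocking {r : ℕ} (hr : 0 < r) (v : FG r) : Prop :=
  ∀ p : FG r, Primitive hr p → CyclicallyReduced p → ¬ v.toWord <:+: p.toWord

/-- `v` is `w`-orbit-blocking: for every automorphism `φ` with `φ w` cyclically reduced,
the reduced word of `v` is not an infix of the reduced word of `φ w`. -/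
def OrbitBlocking {r : ℕ} (w v : FG r) : Prop :=
  ∀ φ : FG r ≃* FG r, CyclicallyReduced (φ w) → ¬ v.toWord <:+: (φ w).toWord

/-- `u` is positive: every letter of its reduced word is a generator (not an inverse). -/
def Positive {r : ℕ} (u : FG r) : Prop := ∀ l ∈ u.toWord, l.2 = true

/-- The cyclic length `‖u‖`: the minimum of `|g u g⁻¹|` over all `g`. -/
noncomputable def cyclicLength {r : ℕ} (u : FG r) : ℕ :=
  sInf (Set.range fun g : FG r => wordLength (g * u * g⁻¹))

/-- `gen r j` is the generator `x_{j+1}` of `F_r` (0-indexed: the `j`-th generator),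
for `j < r`. -/
def gen (r : ℕ) (j : ℕ) : FG r :=
  if h : j < r then FreeGroup.of ⟨j, h⟩ else 1

/-- `(b_1, …, b_r)` is a basis of `F_r`: some automorphism sends `x_i` to `b_i`. -/
def IsBasis {r : ℕ} (b : Fin r → FG r) : Prop :=
  ∃ φ : FG r ≃* FG r, ∀ i, φ (FreeGroup.of i) = b i

namespace FreeGroup

variable {α : Type*}

/-- The automorphism sending `x` to `x * g` and fixing all other generators, where `g` does not
involve `x`. -/
theorem exists_mulEquiv_of_eq_of_mul [DecidableEq α] {S : Set α} {x : α} (hx : x ∉ S)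
    {g : FreeGroup α} (hg : g ∈ Subgroup.closure (of '' S)) :
    ∃ φ : FreeGroup α ≃* FreeGroup α, φ (of x) = of x * g := by
  let f (h : FreeGroup α) : FreeGroup α →* FreeGroup α :=
    lift fun i => if i = x then of x * h else of i
  have fixes (h) : Set.EqOn (f h) (MonoidHom.id _) (Subgroup.closure (of '' S)) := by
    refine MonoidHom.eqOn_closure ?_
    rintro _ ⟨i, hi, rfl⟩
    have : i ≠ x := fun e => hx (e ▸ hi)
    simp [f, this]
  have fg (h) : f h g = g := fixes h hg
  have fgi (h) : f h g⁻¹ = g⁻¹ := fixes h (inv_mem hg)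
  refine ⟨MonoidHom.toMulEquiv (f g) (f g⁻¹) ?_ ?_, by
    change f g (of x) = _
    simp [f]⟩
  · ext i
    by_cases hi : i = x
    · subst hi
      have e : f g (of i) = of i * g := by simp [f]
      have e' : f g⁻¹ (of i) = of i * g⁻¹ := by simp [f]
      simp [e, e', fg]
    · simp [f, hi]
  · ext i
    by_cases hi : i = x
    · subst hi
      have e : f g (of i) = of i * g := by simp [f]
      have e' : f g⁻¹ (of i) = of i * g⁻¹ := by simp [f]
      rw [MonoidHom.comp_apply, e', _root_.map_mul, e, fgi]
      simp
    · simp [f, hi]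

/-- The automorphism fixing the generators in `S` and conjugating all others by `g ∈ ⟨S⟩`. -/
theorem exists_mulEquiv_conj {S T : Set α} (hST : Disjoint S T) {g : FreeGroup α}
    (hg : g ∈ Subgroup.closure (of '' S)) :
    ∃ φ : FreeGroup α ≃* FreeGroup α, (∀ i ∈ S, φ (of i) = of i) ∧
      ∀ h ∈ Subgroup.closure (of '' T), φ h = g * h * g⁻¹ := by
  classical
  let f (h : FreeGroup α) : FreeGroup α →* FreeGroup α :=
    lift fun i => if i ∈ S then of i else h * of i * h⁻¹
  have f_of_mem (h) {i} (hi : i ∈ S) : f h (of i) = of i := by simp [f, hi]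
  have f_of_notMem (h) {i} (hi : i ∉ S) : f h (of i) = h * of i * h⁻¹ := by simp [f, hi]
  have fixes (h) : Set.EqOn (f h) (MonoidHom.id _) (Subgroup.closure (of '' S)) := by
    refine MonoidHom.eqOn_closure ?_
    rintro _ ⟨i, hi, rfl⟩
    exact f_of_mem h hi
  have fg (h) : f h g = g := fixes h hg
  refine ⟨MonoidHom.toMulEquiv (f g) (f g⁻¹) ?_ ?_, fun i hi => f_of_mem g hi, fun h hh => ?_⟩
  · ext i
    by_cases hi : i ∈ S
    · simp [f_of_mem, hi]
    · simp [f_of_notMem, hi, fg, mul_assoc]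
  · ext i
    by_cases hi : i ∈ S
    · simp [f_of_mem, hi]
    · simp [f_of_notMem, hi, fg, mul_assoc]
  · have : Set.EqOn (f g) (MulAut.conj g).toMonoidHom (Subgroup.closure (of '' T)) := by
      refine MonoidHom.eqOn_closure ?_
      rintro _ ⟨i, hi, rfl⟩
      simp [f_of_notMem g (hST.notMem_of_mem_right hi)]
    simpa using this hh

theorem fst_mem_of_mem_toWord [DecidableEq α] {S : Set α} {g : FreeGroup α}
    (hg : g ∈ Subgroup.closure (of '' S)) : ∀ l ∈ g.toWord, l.1 ∈ S := by
  induction hg using Subgroup.closure_induction with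
  | mem x hx =>
    obtain ⟨i, hi, rfl⟩ := hx
    simpa using hi
  | one => simp
  | mul x y _ _ hx hy =>
    intro l hl
    rw [toWord_mul] at hl
    have := reduce.red.sublist.subset hl
    rw [List.mem_append] at this
    exact this.elim (hx l) (hy l)
  | inv x _ hx =>
    intro l hl
    simp only [toWord_inv, invRev, List.mem_reverse, List.mem_map] at hl
    obtain ⟨m, hm, rfl⟩ := hl
    exact hx m hm

theorem isReduced_append {L₁ L₂ : List (α × Bool)} (h₁ : IsReduced L₁) (h₂ : IsReduced L₂)
    (h : ∀ a ∈ L₁.getLast?, ∀ b ∈ L₂.head?, a.1 ≠ b.1) : IsReduced (L₁ ++ L₂) :=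
  List.isChain_append.2 ⟨h₁, h₂, fun a ha b hb e => absurd e (h a ha b hb)⟩

theorem IsReduced.invRev {L : List (α × Bool)} (h : IsReduced L) :
    IsReduced (invRev L) := by
  classical
  rw [isReduced_iff_reduce_eq] at h ⊢
  rw [reduce_invRev, h]

theorem isReduced_append_append_of_disjoint {S T : Set α} (hST : Disjoint S T)
    {L₁ L₂ L₃ : List (α × Bool)} (h₁ : IsReduced L₁) (h₂ : IsReduced L₂) (h₃ : IsReduced L₃)
    (m₁ : ∀ l ∈ L₁, l.1 ∈ S) (m₂ : ∀ l ∈ L₂, l.1 ∈ T) (m₃ : ∀ l ∈ L₃, l.1 ∈ S) (hne : L₂ ≠ []) :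
    IsReduced (L₁ ++ L₂ ++ L₃) := by
  refine isReduced_append (isReduced_append h₁ h₂ fun a ha b hb => ?_) h₃ fun a ha b hb => ?_
  · exact hST.ne_of_mem (m₁ a (List.mem_of_mem_getLast? ha)) (m₂ b (List.mem_of_mem_head? hb))
  · rw [List.getLast?_append_of_ne_nil _ hne] at ha
    exact (hST.ne_of_mem (m₃ b (List.mem_of_mem_head? hb))
      (m₂ a (List.mem_of_mem_getLast? ha))).symm

theorem exists_isReduced_cons (a : α) {L : List (α × Bool)} (h : IsReduced L) :
    ∃ b, IsReduced ((a, b) :: L) := by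
  rcases L with _ | ⟨⟨c, d⟩, L⟩
  · exact ⟨true, List.isChain_singleton _⟩
  · exact ⟨d, List.isChain_cons_cons.2 ⟨fun _ => rfl, h⟩⟩

/-- If `x ≠ a` lie in `S` and `T` is disjoint from `S`, then for `u ∈ ⟨S⟩` and `1 ≠ v ∈ ⟨T⟩` some
automorphic image of `x` has the form `x a^{±1} u v u⁻¹ a^{∓1}`, reduced as written. -/
theorem exists_mulEquiv_toWord_eq [DecidableEq α] {S T : Set α} (hST : Disjoint S T) {x a : α}
    (hx : x ∈ S) (ha : a ∈ S) (hxa : x ≠ a) {u v : FreeGroup α}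
    (hu : u ∈ Subgroup.closure (of '' S)) (hv : v ∈ Subgroup.closure (of '' T)) (hv1 : v ≠ 1) :
    ∃ (φ : FreeGroup α ≃* FreeGroup α) (b : Bool), (φ (of x)).toWord =
      (x, true) :: (a, b) :: (u.toWord ++ v.toWord ++ invRev u.toWord ++ [(a, !b)]) := by
  obtain ⟨b, hb⟩ := exists_isReduced_cons a (isReduced_toWord (x := u))
  let g : FreeGroup α := mk [(a, b)] * u
  have hab : mk [(a, b)] ∈ Subgroup.closure (of '' S) := by
    have := Subgroup.subset_closure (Set.mem_image_of_mem of ha)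
    cases b
    · exact inv_mem this
    · exact this
  have hg : g ∈ Subgroup.closure (of '' S) := mul_mem hab hu
  have gw : g.toWord = (a, b) :: u.toWord := by
    rw [toWord_mul, toWord_mk, IsReduced.reduce_eq (List.isChain_singleton _)]
    exact hb.reduce_eq
  obtain ⟨φ, hφ⟩ := exists_mulEquiv_of_eq_of_mul (hST.notMem_of_mem_left hx) hv
  obtain ⟨ψ, hψ, hψ'⟩ := exists_mulEquiv_conj hST hg
  refine ⟨φ.trans ψ, b, ?_⟩
  have key : (φ.trans ψ) (of x) =
      mk ((x, true) :: (g.toWord ++ v.toWord ++ invRev g.toWord)) := by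
    have : (φ.trans ψ) (of x) = of x * (g * v * g⁻¹) := by
      simp [hφ, hψ x hx, hψ' v hv]
    rw [this, ← List.singleton_append, ← mul_mk, ← mul_mk, ← mul_mk, ← inv_mk, mk_toWord, mk_toWord]
    rfl
  have inner : IsReduced (g.toWord ++ v.toWord ++ invRev g.toWord) := by
    refine isReduced_append_append_of_disjoint hST isReduced_toWord isReduced_toWord
      isReduced_toWord.invRev (fst_mem_of_mem_toWord hg) (fst_mem_of_mem_toWord hv) ?_
      (by simpa using hv1)
    rw [← toWord_inv]
    exact fst_mem_of_mem_toWord (inv_mem hg)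
  rw [key, toWord_mk, IsReduced.reduce_eq]
  · simp [gw, invRev]
  · rw [gw] at inner ⊢
    exact List.isChain_cons_cons.2 ⟨fun e => absurd e hxa, inner⟩

end FreeGroup

theorem primitive_mulEquiv_of {r : ℕ} (hr : 0 < r) (φ : FG r ≃* FG r) (x : Fin r) :
    Primitive hr (φ (FreeGroup.of x)) :=
  ⟨(FreeGroup.freeGroupCongr (Equiv.swap ⟨0, hr⟩ x)).trans φ, by simp⟩

theorem Primitive.inv {r : ℕ} {hr : 0 < r} {p : FG r} (hp : Primitive hr p) :
    Primitive hr p⁻¹ := by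
  obtain ⟨φ, rfl⟩ := hp
  let f : FG r →* FG r := FreeGroup.lift fun i => (FreeGroup.of i)⁻¹
  have hf : f.comp f = MonoidHom.id _ := by ext; simp [f]
  exact ⟨(MonoidHom.toMulEquiv f f hf hf).trans φ, by simp [f]⟩

theorem CyclicallyReduced.inv {r : ℕ} {p : FG r} (hp : CyclicallyReduced p) :
    CyclicallyReduced p⁻¹ := by
  intro a ha b hb hab
  simp only [FreeGroup.toWord_inv, FreeGroup.invRev, List.head?_reverse, List.getLast?_reverse,
    List.getLast?_map, List.head?_map, Option.mem_def, Option.map_eq_some_iff] at ha hb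
  obtain ⟨a', ha', rfl⟩ := ha
  obtain ⟨b', hb', rfl⟩ := hb
  refine hp b' hb' a' ha' ?_
  simp only [Prod.mk.injEq, Bool.not_not] at hab
  exact Prod.ext hab.1.symm hab.2.symm

theorem toWord_inv_infix {r : ℕ} {v p : FG r} (h : v.toWord <:+: p.toWord) :
    v⁻¹.toWord <:+: p⁻¹.toWord := by
  simpa only [FreeGroup.toWord_inv, FreeGroup.invRev, List.reverse_infix] using h.map _

theorem exists_primitive_infix_of_nontrivial {r : ℕ} (hr : 0 < r) {X Y : Set (Fin r)}
    (hD : Disjoint X Y) (hX : X.Nontrivial) (hY : Y.Nonempty) {wX wY : FG r}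
    (hwX : wX ∈ Subgroup.closure (FreeGroup.of '' X))
    (hwY : wY ∈ Subgroup.closure (FreeGroup.of '' Y)) :
    ∃ p : FG r, Primitive hr p ∧ CyclicallyReduced p ∧ (wX * wY).toWord <:+: p.toWord := by
  obtain ⟨x, hx, a, ha, hxa⟩ := hX
  obtain ⟨y, hy⟩ := hY
  obtain ⟨v, hv, hv1, hpre⟩ : ∃ v ∈ Subgroup.closure (FreeGroup.of '' Y), v ≠ 1 ∧
      wY.toWord <+: v.toWord := by
    by_cases h : wY = 1
    · exact ⟨FreeGroup.of y, Subgroup.subset_closure (Set.mem_image_of_mem _ hy),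
        FreeGroup.of_ne_one y, by simp [h]⟩
    · exact ⟨wY, hwY, h, List.prefix_rfl⟩
  obtain ⟨φ, b, hφ⟩ := FreeGroup.exists_mulEquiv_toWord_eq hD hx ha hxa hwX hv hv1
  refine ⟨_, primitive_mulEquiv_of hr φ x, ?_, ?_⟩
  · intro c hc d hd
    rw [hφ, ← List.cons_append, ← List.cons_append, List.getLast?_concat] at hd
    rw [hφ] at hc
    simp only [List.head?_cons, Option.mem_def, Option.some.injEq] at hc hd
    subst hc hd
    simp [hxa]
  · have hw : (wX * wY).toWord = wX.toWord ++ wY.toWord := by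
      rw [FreeGroup.toWord_mul]
      refine (FreeGroup.isReduced_append FreeGroup.isReduced_toWord
        FreeGroup.isReduced_toWord fun c hc d hd => ?_).reduce_eq
      exact hD.ne_of_mem (FreeGroup.fst_mem_of_mem_toWord hwX c (List.mem_of_mem_getLast? hc))
        (FreeGroup.fst_mem_of_mem_toWord hwY d (List.mem_of_mem_head? hd))
    obtain ⟨t, ht⟩ := hpre
    rw [hw, hφ, ← ht]
    exact ⟨[(x, true), (a, b)], t ++ FreeGroup.invRev wX.toWord ++ [(a, !b)], by simp⟩

/-- Let `r ≥ 3` and let the generating set be partitioned into two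
disjoint nonempty subsets `X` and `Y`.  If `w = w_X w_Y` with `w_X ∈ ⟨X⟩` and
`w_Y ∈ ⟨Y⟩`, then `w` is not primitivity-blocking: some cyclically reduced primitive
element contains the reduced word of `w` as an infix. -/
theorem not_pb_of_split_product {r : ℕ} (hr : 3 ≤ r) (X Y : Set (Fin r))
    (hU : X ∪ Y = Set.univ) (hD : Disjoint X Y) (hX : X.Nonempty) (hY : Y.Nonempty)
    (wX wY : FG r)
    (hwX : wX ∈ Subgroup.closure (FreeGroup.of '' X))
    (hwY : wY ∈ Subgroup.closure (FreeGroup.of '' Y)) :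
    ∃ p : FG r, Primitive (by omega) p ∧ CyclicallyReduced p ∧
      (wX * wY).toWord <:+: p.toWord := by
  by_cases hX' : X.Nontrivial
  · exact exists_primitive_infix_of_nontrivial _ hD hX' hY hwX hwY
  · have hY' : Y.Nontrivial := by
      by_contra hY'
      rw [Set.not_nontrivial_iff] at hX' hY'
      have h1 := Set.ncard_union_le X Y
      have h2 := Set.ncard_le_one_iff_subsingleton.2 hX'
      have h3 := Set.ncard_le_one_iff_subsingleton.2 hY'
      rw [hU, Set.ncard_univ, Nat.card_fin] at h1
      omega
    obtain ⟨p, hp, hc, hi⟩ := exists_primitive_infix_of_nontrivial (by omega) hD.symm hY' hX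
      (inv_mem hwY) (inv_mem hwX)
    refine ⟨p⁻¹, hp.inv, hc.inv, ?_⟩
    simpa using toWord_inv_infix hi
end

section
/- In the free group F_2, the word x_1⁻¹ x_2 x_1 is primitivity-blocking, and it is a shortest primitivity-blocking word: every element of F_2 whose reduced word has length at most 2 is not primitivity-blocking. -/
namespace FreeGroup

section Words

variable {α : Type*} {L M y : List (α × Bool)}

theorem IsCyclicallyReduced.isReduced_append_append (h : IsCyclicallyReduced L) :
    IsReduced (L ++ (L ++ L)) := by
  simpa [List.replicate_succ] using (h.flatten_replicate 3).isReduced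

theorem isCyclicallyReduced_of_isReduced_append_self (h : IsReduced (L ++ L)) :
    IsCyclicallyReduced L := by
  rw [IsReduced, List.isChain_append] at h
  exact ⟨h.1, h.2.2⟩

theorem IsCyclicallyReduced.of_isRotated (h : IsCyclicallyReduced L) (hr : M ~r L) :
    IsCyclicallyReduced M := by
  obtain ⟨n, hn, rfl⟩ := List.isRotated_iff_mod.1 hr.symm
  apply isCyclicallyReduced_of_isReduced_append_self
  rw [List.rotate_eq_drop_append_take hn]
  refine h.isReduced_append_append.infix ⟨L.take n, L.drop n, ?_⟩
  simp only [List.append_assoc, List.take_append_drop]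
  simp only [← List.append_assoc, List.take_append_drop]

theorem exists_conj_of_isRotated (hr : M ~r L) : ∃ k : FreeGroup α, mk L * k = k * mk M := by
  obtain ⟨n, hn, rfl⟩ := List.isRotated_iff_mod.1 hr.symm
  refine ⟨mk (L.take n), ?_⟩
  rw [List.rotate_eq_drop_append_take hn]
  rw [← mul_mk, ← mul_assoc, mul_mk (L₂ := L.drop n), List.take_append_drop]

variable [DecidableEq α]

theorem isReduced_invRev (h : IsReduced L) : IsReduced (invRev L) := by
  rw [isReduced_iff_reduce_eq, reduce_invRev, h.reduce_eq]

theorem IsCyclicallyReduced.invRev (h : IsCyclicallyReduced L) :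
    IsCyclicallyReduced (invRev L) := by
  apply isCyclicallyReduced_of_isReduced_append_self
  rw [← invRev_append]
  exact isReduced_invRev (h.isReduced_append_append.infix ⟨L, [], by simp⟩)

end Words

section AlmostInvariant

variable {α : Type*}

/-- A set which every left translation changes by finitely many elements only. -/
def AlmostInvariant (A : Set (FreeGroup α)) : Prop :=
  ∀ h : FreeGroup α, {g | ¬(h * g ∈ A ↔ g ∈ A)}.Finite

theorem almostInvariant_of_generators {A : Set (FreeGroup α)}
    (hA : ∀ i, {g | ¬(of i * g ∈ A ↔ g ∈ A)}.Finite) : AlmostInvariant A := by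
  intro h
  induction h using FreeGroup.induction_on with
  | C1 => simp
  | of i => exact hA i
  | inv_of i _ =>
    refine ((hA i).preimage (f := fun g => (of i)⁻¹ * g)
      (mul_right_injective _).injOn).subset fun g hg => ?_
    simp only [Set.mem_ofPred_eq, Set.mem_preimage, mul_inv_cancel_left] at hg ⊢
    tauto
  | mul a b ha hb =>
    refine ((ha.preimage (f := fun g => b * g) (mul_right_injective _).injOn).union hb).subset
      fun g hg => ?_
    simp only [Set.mem_ofPred_eq, Set.mem_preimage, Set.mem_union, mul_assoc] at hg ⊢
    tauto

theorem AlmostInvariant.preimage {A : Set (FreeGroup α)} (hA : AlmostInvariant A)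
    (ψ : FreeGroup α ≃* FreeGroup α) : AlmostInvariant (ψ ⁻¹' A) := by
  intro h
  refine ((hA (ψ h)).preimage ψ.injective.injOn).subset fun g hg => ?_
  simpa using hg

variable [DecidableEq α]

/-- Among the elements whose reduced word ends with `y`, all but finitely many
satisfy `g ∈ A ↔ E`. -/
def EventuallyOn (A : Set (FreeGroup α)) (y : List (α × Bool)) (E : Prop) : Prop :=
  {g : FreeGroup α | y <:+ g.toWord ∧ ¬(g ∈ A ↔ E)}.Finite

variable {A : Set (FreeGroup α)} {y M : List (α × Bool)} {p k : FreeGroup α} {E E' : Prop}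

theorem EventuallyOn.iff_of_axis (hA : AlmostInvariant A) (hp : ∀ g, p * g ∈ A ↔ g ∈ A)
    (hM : IsCyclicallyReduced M) (hk : p * k = k * mk M) {x : α × Bool} (hx : [x] <:+ M)
    (hy : IsReduced (x :: y)) (hE : EventuallyOn A (x :: y) E) : E ↔ k * mk y ∈ A := by
  obtain ⟨t, rfl⟩ := hx
  have hred : IsReduced ((t ++ [x]) ++ y) :=
    IsReduced.append_overlap hM.isReduced hy (by simp)
  let g : ℕ → FreeGroup α := fun n => mk (t ++ [x]) ^ (n + 1) * mk y
  have hword : ∀ n, (g n).toWord = (List.replicate (n + 1) (t ++ [x])).flatten ++ y := by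
    intro n
    have := IsReduced.append_flatten_replicate_append (L₁ := []) hM (by simpa using hred)
      n.succ_ne_zero
    simp only [g, pow_mk, mul_mk, toWord_mk]
    exact IsReduced.reduce_eq (by simpa using this)
  have hinj : Function.Injective g := by
    intro m n h
    have := congrArg (fun g => g.toWord.length) h
    simp only [hword, List.length_append, List.length_flatten, List.map_replicate,
      List.sum_replicate, smul_eq_mul, List.length_singleton] at this
    have := Nat.eq_of_mul_eq_mul_right (Nat.succ_pos _) (Nat.add_right_cancel this)
    omega
  have hfin := (hE.preimage hinj.injOn).union ((hA k).preimage hinj.injOn)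
  obtain ⟨n, hn⟩ := hfin.exists_notMem
  have hsuf : x :: y <:+ (g n).toWord := by
    rw [hword, List.replicate_succ', List.flatten_append]
    exact ⟨(List.replicate n (t ++ [x])).flatten ++ t, by simp⟩
  have hpow : ∀ m : ℕ, ∀ h, p ^ m * h ∈ A ↔ h ∈ A := by
    intro m
    induction m with
    | zero => simp
    | succ m ih => intro h; rw [pow_succ, mul_assoc, ih, hp]
  have hconj : k * g n = p ^ (n + 1) * (k * mk y) := by
    have : SemiconjBy k (mk (t ++ [x])) p := hk.symm
    simp only [g, ← mul_assoc, (this.pow_right (n + 1)).eq]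
  simp only [Set.mem_union, Set.mem_preimage, Set.mem_ofPred_eq, hsuf, true_and, not_or,
    not_not, hconj, hpow] at hn
  tauto

theorem EventuallyOn.iff_of_isRotated (hA : AlmostInvariant A) (hp : ∀ g, p * g ∈ A ↔ g ∈ A)
    (hc : IsCyclicallyReduced p.toWord) {x z : α × Bool} {t : List (α × Bool)}
    (hr : z :: (t ++ [x]) ~r p.toWord)
    (hx : IsReduced (x :: y)) (hz : IsReduced ((z.1, !z.2) :: y))
    (hE : EventuallyOn A (x :: y) E) (hE' : EventuallyOn A ((z.1, !z.2) :: y) E') :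
    E ↔ E' := by
  obtain ⟨k, hk⟩ := exists_conj_of_isRotated hr
  rw [mk_toWord] at hk
  have hM := hc.of_isRotated hr
  rw [hE.iff_of_axis hA hp hM hk ⟨z :: t, by simp⟩ hx]
  refine (hE'.iff_of_axis (p := p⁻¹) (k := k) hA (fun g => ?_) hM.invRev ?_ ?_ hz).symm
  · rw [← hp, mul_inv_cancel_left]
  · have : SemiconjBy k (mk (z :: (t ++ [x]))) p := hk.symm
    rw [← inv_mk]
    exact this.inv_right.eq.symm
  · exact ⟨invRev (t ++ [x]), by simp [invRev]⟩

theorem AlmostInvariant.exists_eventuallyOn_of_length [Finite α] (hA : AlmostInvariant A) :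
    ∃ N, ∀ y : List (α × Bool), IsReduced y → N ≤ y.length → ∃ E, EventuallyOn A y E := by
  have hfin : (⋃ s : α × Bool, {g | ¬(mk [s] * g ∈ A ↔ g ∈ A)}).Finite :=
    Set.finite_iUnion fun s => hA _
  obtain ⟨N, hN⟩ := (hfin.image fun g => g.toWord.length).bddAbove
  refine ⟨N + 1, fun y hy hlen => ⟨mk y ∈ A, ?_⟩⟩
  have key : ∀ t : List (α × Bool), IsReduced (t ++ y) → (mk (t ++ y) ∈ A ↔ mk y ∈ A) := by
    intro t
    induction t with
    | nil => simp
    | cons s t ih =>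
      intro h
      have ht : IsReduced (t ++ y) := h.infix ⟨[s], [], by simp⟩
      rw [← ih ht]
      by_contra hne
      have hmem : (mk (t ++ y)).toWord.length ≤ N := by
        refine hN ⟨_, Set.mem_iUnion.2 ⟨s, ?_⟩, rfl⟩
        simpa [mul_mk] using hne
      rw [toWord_mk, ht.reduce_eq, List.length_append] at hmem
      omega
  refine Set.Finite.subset Set.finite_empty fun g ⟨⟨t, ht⟩, hg⟩ => hg ?_
  rw [← mk_toWord (x := g), ← ht]
  exact key t (ht ▸ isReduced_toWord)

/-- The set of elements whose reduced word ends with a letter `x_j^±`. -/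
def endsWith (j : α) : Set (FreeGroup α) := {g | ∃ s ∈ g.toWord.getLast?, s.1 = j}

theorem getLast?_toWord_of_mul (i : α) {g : FreeGroup α} (h₁ : g ≠ 1) (h₂ : g ≠ (of i)⁻¹) :
    (of i * g).toWord.getLast? = g.toWord.getLast? := by
  have hred : reduce g.toWord = g.toWord := reduce_toWord g
  have h₁ : g.toWord ≠ [] := by simpa using h₁
  have h₂ : g.toWord ≠ [(i, false)] := fun h => h₂ (toWord_injective (by simpa [invRev] using h))
  rw [toWord_mul, toWord_of, List.singleton_append, reduce.cons, hred]
  match hw : g.toWord with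
  | [] => exact absurd hw h₁
  | [(j, b)] =>
    rw [hw] at h₂
    dsimp only
    split_ifs with h
    · simp_all
    · simp
  | s :: s' :: t =>
    dsimp only
    split_ifs <;> simp

theorem almostInvariant_endsWith (j : α) : AlmostInvariant (endsWith j) := by
  refine almostInvariant_of_generators fun i => ?_
  refine (Set.toFinite {1, (of i)⁻¹}).subset fun g hg => ?_
  by_contra h
  simp only [Set.mem_insert_iff, Set.mem_singleton_iff, not_or] at h
  simp [endsWith, getLast?_toWord_of_mul i h.1 h.2] at hg

theorem of_mul_mem_endsWith {i j : α} (hij : i ≠ j) (g : FreeGroup α) :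
    of i * g ∈ endsWith j ↔ g ∈ endsWith j := by
  by_cases h₁ : g = 1
  · simp [h₁, endsWith, hij]
  by_cases h₂ : g = (of i)⁻¹
  · simp [h₂, endsWith, invRev, hij]
  simp [endsWith, getLast?_toWord_of_mul i h₁ h₂]

end AlmostInvariant

/-- If the reduced word of `p` passes, cyclically and up to inversion, between any letter `x_1^±`
and any letter `x_2^±` (the Whitehead graph of `p` contains a 4-cycle), then an almost invariant
set that is invariant under left multiplication by `p` is finite or cofinite. -/
theorem AlmostInvariant.exists_finite_setOf_not_iff {A : Set (FreeGroup (Fin 2))}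
    {p : FreeGroup (Fin 2)} (hA : AlmostInvariant A) (hp : ∀ g, p * g ∈ A ↔ g ∈ A)
    (hc : IsCyclicallyReduced p.toWord)
    (hedge : ∀ b c : Bool, (∃ t, ((1, !c) :: (t ++ [(0, b)])) ~r p.toWord) ∨
      ∃ t, ((0, !b) :: (t ++ [(1, c)])) ~r p.toWord) :
    ∃ E : Prop, {g | ¬(g ∈ A ↔ E)}.Finite := by
  obtain ⟨N, hN⟩ := hA.exists_eventuallyOn_of_length
  have hadj : ∀ (y : List (Fin 2 × Bool)) (b c : Bool) (E E' : Prop),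
      IsReduced ((0, b) :: y) → IsReduced ((1, c) :: y) → EventuallyOn A ((0, b) :: y) E →
      EventuallyOn A ((1, c) :: y) E' → (E ↔ E') := by
    intro y b c E E' hb hc' hE hE'
    obtain ⟨t, ht⟩ | ⟨t, ht⟩ := hedge b c
    · exact hE.iff_of_isRotated hA hp hc ht hb (by simpa using hc') (by simpa using hE')
    · exact (hE'.iff_of_isRotated hA hp hc ht hc' (by simpa using hb) (by simpa using hE)).symm
  have main : ∀ n, ∀ y : List (Fin 2 × Bool), IsReduced y → N ≤ y.length + n →
      ∃ E, EventuallyOn A y E := by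
    intro n
    induction n with
    | zero => exact fun y hy h => hN y hy (by simpa using h)
    | succ n ih =>
      intro y hy hlen
      have ih' : ∀ s, IsReduced (s :: y) → ∃ E, EventuallyOn A (s :: y) E :=
        fun s hs => ih _ hs (by simp only [List.length_cons]; omega)
      obtain ⟨b, hb⟩ : ∃ b, IsReduced (((0 : Fin 2), b) :: y) := by
        match y with
        | [] => exact ⟨true, IsReduced.singleton⟩
        | (j, d) :: y => exact ⟨d, by simpa using hy⟩
      obtain ⟨c, hc'⟩ : ∃ c, IsReduced (((1 : Fin 2), c) :: y) := by
        match y with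
        | [] => exact ⟨true, IsReduced.singleton⟩
        | (j, d) :: y => exact ⟨d, by simpa using hy⟩
      obtain ⟨E, hE⟩ := ih' _ hb
      obtain ⟨E', hE'⟩ := ih' _ hc'
      have hEE' := hadj y b c E E' hb hc' hE hE'
      have hall : ∀ s, IsReduced (s :: y) → EventuallyOn A (s :: y) E := by
        rintro ⟨i, d⟩ hs
        obtain ⟨F, hF⟩ := ih' _ hs
        have : F ↔ E := by
          match i with
          | 0 => exact (hadj y d c F E' hs hc' hF hE').trans hEE'.symm
          | 1 => exact (hadj y b d E F hb hs hE hF).symm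
        rwa [propext this] at hF
      refine ⟨E, ((Set.finite_singleton (mk y)).union (Set.finite_iUnion
        (fun s : {s // IsReduced (s :: y)} => hall s.1 s.2))).subset ?_⟩
      rintro g ⟨⟨t, ht⟩, hg⟩
      rcases t.eq_nil_or_concat with rfl | ⟨t, s, rfl⟩
      · left
        rw [Set.mem_singleton_iff, ← mk_toWord (x := g), ← ht, List.nil_append]
      · right
        have hs : s :: y <:+ g.toWord := ⟨t, by simpa using ht⟩
        exact Set.mem_iUnion.2 ⟨⟨s, isReduced_toWord.infix hs.isInfix⟩, hs, hg⟩
  obtain ⟨E, hE⟩ := main N [] IsReduced.nil (by simp)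
  exact ⟨E, by simpa [EventuallyOn] using hE⟩

/-- The Whitehead graph of a cyclically reduced primitive element of `F_2` does not contain the
4-cycle joining every `x_1^±` to every `x_2^±`. -/
theorem not_isRotated_of_primitive (φ : FreeGroup (Fin 2) ≃* FreeGroup (Fin 2))
    (hc : IsCyclicallyReduced (φ (of 0)).toWord) :
    ¬ ∀ b c : Bool, (∃ t, ((1, !c) :: (t ++ [(0, b)])) ~r (φ (of 0)).toWord) ∨
      ∃ t, ((0, !b) :: (t ++ [(1, c)])) ~r (φ (of 0)).toWord := by
  intro hedge
  have hinv : ∀ g, φ (of 0) * g ∈ φ.symm ⁻¹' endsWith 1 ↔ g ∈ φ.symm ⁻¹' endsWith 1 := by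
    intro g
    simp [of_mul_mem_endsWith (show (0 : Fin 2) ≠ 1 by decide)]
  obtain ⟨E, hE⟩ :=
    ((almostInvariant_endsWith 1).preimage φ.symm).exists_finite_setOf_not_iff hinv hc hedge
  have hinj : ∀ i, Function.Injective fun n : ℕ => φ (of i ^ (n + 1)) := by
    intro i m n h
    simpa using congrArg norm (φ.injective h)
  obtain ⟨n, hn⟩ := (hE.preimage (hinj 0).injOn).exists_notMem
  obtain ⟨m, hm⟩ := (hE.preimage (hinj 1).injOn).exists_notMem
  simp only [Set.mem_preimage, Set.mem_ofPred_eq, not_not, φ.symm_apply_apply, endsWith,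
    toWord_of_pow, List.replicate_succ', List.getLast?_concat] at hn hm
  simp at hn hm
  exact hn hm

end FreeGroup

open FreeGroup

theorem List.exists_adjacent_of_not {β : Type*} {P : β → Prop} {c d : β} (hc : P c) (hd : ¬P d) :
    ∀ l : List β, ∃ l₁ x z l₂, c :: (l ++ [d]) = l₁ ++ x :: z :: l₂ ∧ P x ∧ ¬P z := by
  intro l
  induction l generalizing c with
  | nil => exact ⟨[], c, d, [], rfl, hc, hd⟩
  | cons e l ih =>
    by_cases he : P e
    · obtain ⟨l₁, x, z, l₂, h, hx, hz⟩ := ih he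
      exact ⟨c :: l₁, x, z, l₂, by simp [← h], hx, hz⟩
    · exact ⟨[], c, e, l ++ [d], rfl, hc, he⟩

/-- Two consecutive letters of the closed-up word `c :: d :: l ++ [c]` are cyclically
consecutive in `c :: d :: l`. -/
theorem List.exists_isRotated_of_adjacent {β : Type*} {c d x z : β} {l l₁ l₂ : List β}
    (h : c :: d :: (l ++ [c]) = l₁ ++ x :: z :: l₂) :
    ∃ t, z :: (t ++ [x]) ~r c :: d :: l := by
  rcases l₂.eq_nil_or_concat with rfl | ⟨l₂, e, rfl⟩
  · have h' : (c :: d :: l) ++ [c] = (l₁ ++ [x]) ++ [z] := by simpa using h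
    obtain ⟨h₁, h₂⟩ := List.append_inj' h' rfl
    obtain rfl : c = z := by simpa using h₂
    cases l₁ with
    | nil => simp at h₁
    | cons f l₁ =>
      obtain ⟨rfl, h₁⟩ := List.cons.inj h₁
      exact ⟨l₁, by rw [h₁, List.cons_append]⟩
  · have h' : (c :: d :: l) ++ [c] = (l₁ ++ x :: z :: l₂) ++ [e] := by simpa using h
    obtain ⟨h₁, -⟩ := List.append_inj' h' rfl
    refine ⟨l₂ ++ l₁, ?_⟩
    rw [h₁]
    simpa using List.isRotated_append (l := z :: l₂) (l' := l₁ ++ [x])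

theorem CyclicallyReduced.isCyclicallyReduced {r : ℕ} {p : FG r} (h : CyclicallyReduced p) :
    IsCyclicallyReduced p.toWord := by
  refine ⟨isReduced_toWord, fun a ha b hb hab => ?_⟩
  have := h b hb a ha
  by_contra hne
  exact this (Prod.ext hab.symm (by simpa using (Bool.eq_not.2 (Ne.symm hne))))

theorem edges_of_adjacent (Adj : Fin 2 × Bool → Fin 2 × Bool → Prop)
    (h₁ : Adj (0, false) (1, true)) (h₂ : Adj (1, true) (0, true)) {x z x' z' : Fin 2 × Bool}
    (h : Adj x z ∧ (x.1 = z.1 → x.2 = z.2)) (hx : x.2 = true) (hz : ¬z.2 = true)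
    (h' : Adj x' z' ∧ (x'.1 = z'.1 → x'.2 = z'.2)) (hx' : x'.2 = true ↔ x'.1 = 0)
    (hz' : ¬(z'.2 = true ↔ z'.1 = 0)) (b c : Bool) :
    Adj (0, b) (1, !c) ∨ Adj (1, c) (0, !b) := by
  match b, c with
  | false, false => exact Or.inl h₁
  | false, true => exact Or.inr h₂
  | true, true =>
    clear h' hx' hz' h₁ h₂
    obtain ⟨i, b⟩ := x
    obtain ⟨j, c⟩ := z
    fin_cases i <;> fin_cases j <;> cases b <;> cases c <;> simp_all
  | true, false =>
    clear h hx hz h₁ h₂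
    obtain ⟨i, b⟩ := x'
    obtain ⟨j, c⟩ := z'
    fin_cases i <;> fin_cases j <;> cases b <;> cases c <;> simp_all

/-- The Whitehead graph of a cyclically reduced word containing `x_1⁻¹ x_2 x_1` contains the
4-cycle joining every `x_1^±` to every `x_2^±`. -/
theorem isRotated_of_infix {L : List (Fin 2 × Bool)} (hc : IsCyclicallyReduced L)
    (h : [(0, false), (1, true), (0, true)] <:+: L) (b c : Bool) :
    (∃ t, ((1, !c) :: (t ++ [(0, b)])) ~r L) ∨ ∃ t, ((0, !b) :: (t ++ [(1, c)])) ~r L := by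
  obtain ⟨u, v, rfl⟩ := h
  set w : List (Fin 2 × Bool) := (0, false) :: (1, true) :: (0, true) :: (v ++ u) with hw
  have hr : w ~r u ++ [(0, false), (1, true), (0, true)] ++ v := by
    have hw' : w = ([(0, false), (1, true), (0, true)] ++ v) ++ u := by simp [hw]
    rw [hw', List.append_assoc u]
    exact List.isRotated_append
  have hwc := hc.of_isRotated hr
  have hred : IsReduced (w ++ [(0, false)]) :=
    hwc.isReduced_append_append.infix ⟨[], (1, true) :: (0, true) :: (v ++ u) ++ w, by simp [hw]⟩
  have hadj : ∀ {l₁ l₂ x z}, w ++ [(0, false)] = l₁ ++ x :: z :: l₂ →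
      (∃ t, z :: (t ++ [x]) ~r u ++ [(0, false), (1, true), (0, true)] ++ v) ∧
        (x.1 = z.1 → x.2 = z.2) := by
    intro l₁ l₂ x z h
    obtain ⟨t, ht⟩ :=
      List.exists_isRotated_of_adjacent (l := (0, true) :: (v ++ u)) (c := (0, false)) h
    refine ⟨⟨t, ht.trans hr⟩, ?_⟩
    have : IsReduced [x, z] := hred.infix (h ▸ ⟨l₁, l₂, by simp⟩)
    simpa using this
  obtain ⟨l₁, x, z, l₂, h, hx, hz⟩ :=
    List.exists_adjacent_of_not (P := fun s : Fin 2 × Bool => s.2 = true)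
      (c := (1, true)) (d := (0, false)) rfl (by simp) ((0, true) :: (v ++ u))
  obtain ⟨m₁, x', z', m₂, h', hx', hz'⟩ :=
    List.exists_adjacent_of_not (P := fun s : Fin 2 × Bool => (s.2 = true ↔ s.1 = 0))
      (c := (0, true)) (d := (0, false)) (by simp) (by simp) (v ++ u)
  exact edges_of_adjacent
    (fun x z => ∃ t, z :: (t ++ [x]) ~r u ++ [(0, false), (1, true), (0, true)] ++ v)
    (hadj (l₁ := []) (l₂ := (0, true) :: (v ++ u) ++ [(0, false)]) rfl).1
    (hadj (l₁ := [(0, false)]) (l₂ := (v ++ u) ++ [(0, false)]) rfl).1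
    (hadj (l₁ := (0, false) :: l₁) (congrArg (List.cons (0, false)) h)) hx hz
    (hadj (l₁ := (0, false) :: (1, true) :: m₁)
      (congrArg (fun l => (0, false) :: (1, true) :: l) h')) hx' hz' b c

/-- The word `x_i^ε x_i^ε x_j^δ`. -/
def squareWord (i : Fin 2) (ε δ : Bool) : List (Fin 2 × Bool) := [(i, ε), (i, ε), (1 - i, δ)]

theorem primitive_mk_squareWord (i : Fin 2) (ε δ : Bool) :
    Primitive (by norm_num) (mk (squareWord i ε δ) : FG 2) := by
  let f : FG 2 →* FG 2 := lift ![mk (squareWord i ε δ), of i]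
  let g : FG 2 →* FG 2 := lift fun j => if j = i then of 1 else
    if δ then mk [(1, !ε), (1, !ε), (0, true)] else mk [(0, false), (1, ε), (1, ε)]
  have hgf : g.comp f = MonoidHom.id _ := by
    ext j
    fin_cases i <;> fin_cases j <;> cases ε <;> cases δ <;> decide
  have hfg : f.comp g = MonoidHom.id _ := by
    ext j
    fin_cases i <;> fin_cases j <;> cases ε <;> cases δ <;> decide
  exact ⟨MonoidHom.toMulEquiv f g hgf hfg, by simp [f]⟩

theorem not_primitivityBlocking_of_infix_squareWord {u : FG 2} {i : Fin 2} {ε δ : Bool}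
    (h : u.toWord <:+: squareWord i ε δ) : ¬ PrimitivityBlocking (by norm_num) u := by
  have hw : (mk (squareWord i ε δ)).toWord = squareWord i ε δ := by
    fin_cases i <;> cases ε <;> cases δ <;> decide
  intro hb
  refine hb _ (primitive_mk_squareWord i ε δ) ?_ (by rwa [hw])
  intro a ha b hb'
  rw [hw] at ha hb'
  obtain rfl : (i, ε) = a := by simpa [squareWord] using ha
  obtain rfl : (1 - i, δ) = b := by simpa [squareWord] using hb'
  fin_cases i <;> simp

/-- In `F_2`, the word `x_1⁻¹ x_2 x_1` is primitivity-blocking, and it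
is shortest such: no element of reduced length at most `2` is primitivity-blocking. -/
theorem shortest_pb_in_F2 :
    PrimitivityBlocking (by norm_num)
      ((FreeGroup.of 0)⁻¹ * FreeGroup.of 1 * FreeGroup.of 0 : FG 2) ∧
    ∀ u : FG 2, wordLength u ≤ 2 → ¬ PrimitivityBlocking (by norm_num) u := by
  refine ⟨?_, fun u hu => ?_⟩
  · rintro p ⟨φ, rfl⟩ hc h
    have hw : ((of 0)⁻¹ * of 1 * of 0 : FG 2).toWord = [(0, false), (1, true), (0, true)] := by
      decide
    rw [hw] at h
    exact not_isRotated_of_primitive φ hc.isCyclicallyReduced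
      (isRotated_of_infix hc.isCyclicallyReduced h)
  · have hred : IsReduced u.toWord := isReduced_toWord
    rw [wordLength] at hu
    match hw : u.toWord with
    | [] =>
      exact not_primitivityBlocking_of_infix_squareWord (i := 0) (ε := true) (δ := true)
        (hw ▸ List.nil_infix)
    | [(i, b)] =>
      exact not_primitivityBlocking_of_infix_squareWord (i := i) (ε := b) (δ := true)
        (hw ▸ ⟨[], [(i, b), (1 - i, true)], rfl⟩)
    | [(i, b), (j, c)] =>
      by_cases hij : i = j
      · subst hij
        obtain rfl : b = c := by simpa [hw] using hred
        exact not_primitivityBlocking_of_infix_squareWord (i := i) (ε := b) (δ := true)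
          (hw ▸ ⟨[], [(1 - i, true)], rfl⟩)
      · obtain rfl : j = 1 - i := by omega
        exact not_primitivityBlocking_of_infix_squareWord (i := i) (ε := b) (δ := c)
          (hw ▸ ⟨[(i, b)], [], rfl⟩)
    | _ :: _ :: _ :: _ => simp [hw] at hu
end
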